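/- Let F and G be summable ball kernels and let v₀ ∈ D_0(ℚ_p) vanish outside a ball B₀ and be constant on every ball of radius p^{γ₀}. Let v : ℚ_p × [0, ∞) → ℂ be a solution of the Cauchy problem for the quadratic cascade equation with v(·, 0) = v₀, i.e. v satisfies: there exist a ball and a γ ∈ ℤ such that for every t the function v(·, t) vanishes outside that ball, is constant on every ball of radius p^γ, and has mean zero; t ↦ v(x, t) is C¹ on [0, ∞) for each x; and the quadratic cascade equation holds for all x and all t > 0. Then for every t ≥ 0 the function v(·, t) vanishes outside B₀ and is constant on every ball of radius p^{γ₀}. -/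

import Mathlib

open MeasureTheory

/-- The index (base-`p` logarithm of the radius) of the smallest ball of `ℚ_[p]`
containing the two points `x` and `y` (for `x ≠ y`): its radius is `‖x - y‖ = p ^ (-(x-y).valuation)`. -/
noncomputable def supIdx {p : ℕ} [Fact p.Prime] (x y : ℚ_[p]) : ℤ := -(x - y).valuation

/-- The index of the smallest ball containing the three points `x`, `ξ`, `η`
(for pairwise distinct points): its radius is `max (‖x-ξ‖, ‖x-η‖, ‖ξ-η‖)`. -/
noncomputable def sup3Idx {p : ℕ} [Fact p.Prime] (x ξ η : ℚ_[p]) : ℤ :=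
  max (supIdx x ξ) (max (supIdx x η) (supIdx ξ η))

/-- A ball kernel: a function on balls of `ℚ_[p]`, encoded as a function of a center and
an index (log_p of the radius), independent of the choice of center in the ball. -/
def IsBallKernel {p : ℕ} [Fact p.Prime] (F : ℚ_[p] → ℤ → ℂ) : Prop :=
  ∀ c c' : ℚ_[p], ∀ γ : ℤ, dist c c' ≤ (p : ℝ) ^ γ → F c γ = F c' γ

/-- Summability of a ball kernel: for every ball `B(c, p^γ₀)`,
`Σ_{γ > γ₀} ‖F(B(c, p^γ))‖ (p^γ - p^(γ-1)) < ∞`. -/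
def KernelSummable {p : ℕ} [Fact p.Prime] (F : ℚ_[p] → ℤ → ℂ) : Prop :=
  ∀ c : ℚ_[p], ∀ γ₀ : ℤ, Summable (fun n : ℕ =>
    ‖F c (γ₀ + 1 + n)‖ * ((p : ℝ) ^ (γ₀ + 1 + (n : ℤ)) - (p : ℝ) ^ (γ₀ + (n : ℤ))))

/-- An ultrametric wavelet with ball `B(c, p^γ)`: vanishes outside the ball, is constant
on each of the `p` maximal subballs (balls of radius `p^(γ-1)`), has zero mean, and is
not identically zero. -/
def IsWavelet {p : ℕ} [Fact p.Prime] [MeasurableSpace ℚ_[p]] (μ : Measure ℚ_[p])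
    (ψ : ℚ_[p] → ℂ) (c : ℚ_[p]) (γ : ℤ) : Prop :=
  (∀ x, (p : ℝ) ^ γ < dist x c → ψ x = 0) ∧
    (∀ x y, dist x y ≤ (p : ℝ) ^ (γ - 1) → ψ x = ψ y) ∧
    (∫ x, ψ x ∂μ) = 0 ∧ ψ ≠ 0

/-- The eigenvalue `λ_I = T(I) ν(I) + Σ_{J > I} T(J) (ν(J) - ν(J,I))` attached to the ball
`I = B(c, p^γI)` and the ball kernel `T`. -/
noncomputable def lamBall {p : ℕ} [Fact p.Prime] (T : ℚ_[p] → ℤ → ℂ) (c : ℚ_[p]) (γI : ℤ) : ℂ :=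
  T c γI * (((p : ℝ) ^ γI : ℝ) : ℂ) +
    ∑' n : ℕ, T c (γI + 1 + n) *
      (((p : ℝ) ^ (γI + 1 + (n : ℤ)) - (p : ℝ) ^ (γI + (n : ℤ)) : ℝ) : ℂ)

/-- The coefficient `Φ_{I,J}` for balls `J = B(c, p^γJ) ⊊ I = B(c, p^γI)`. -/
noncomputable def PhiIJ {p : ℕ} [Fact p.Prime] (F : ℚ_[p] → ℤ → ℂ) (c : ℚ_[p])
    (γI γJ : ℤ) : ℂ :=
  (((p : ℝ) ^ (2 * (γI - 1)) : ℝ) : ℂ) * F c γI - (((p : ℝ) ^ (2 * γJ) : ℝ) : ℂ) * F c γJ -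
    ∑ γ ∈ Finset.Ioo γJ γI, (((p : ℝ) ^ (2 * γ) - (p : ℝ) ^ (2 * γ - 2) : ℝ) : ℂ) * F c γ

/-- The (spatial) operator of the quadratic cascade equation:
`∫∫ F(sup(x,ξ,η)) f(ξ)(f(η) - f(x)) dμ(ξ) dμ(η) + ∫ G(sup(x,ξ))(f(x) - f(ξ)) dμ(ξ)`. -/
noncomputable def cascadeOp {p : ℕ} [Fact p.Prime] [MeasurableSpace ℚ_[p]]
    (μ : Measure ℚ_[p]) (F G : ℚ_[p] → ℤ → ℂ) (f : ℚ_[p] → ℂ) (x : ℚ_[p]) : ℂ :=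
  (∫ ξ, ∫ η, F x (sup3Idx x ξ η) * (f ξ * (f η - f x)) ∂μ ∂μ) +
    ∫ ξ, G x (supIdx x ξ) * (f x - f ξ) ∂μ

/-- `v` satisfies the quadratic cascade equation
`∂ₜ v(x,t) + ∫∫ F(sup(x,ξ,η)) v(ξ,t)(v(η,t) - v(x,t)) dμ(ξ) dμ(η)
  + ∫ G(sup(x,ξ))(v(x,t) - v(ξ,t)) dμ(ξ) = 0` for all `x ∈ ℚ_p` and all `t > 0`. -/
def SatisfiesCascade {p : ℕ} [Fact p.Prime] [MeasurableSpace ℚ_[p]]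
    (μ : Measure ℚ_[p]) (F G : ℚ_[p] → ℤ → ℂ) (v : ℚ_[p] → ℝ → ℂ) : Prop :=
  ∀ x : ℚ_[p], ∀ t : ℝ, 0 < t →
    HasDerivAt (fun s => v x s) (-(cascadeOp μ F G (fun y => v y t) x)) t


section helpers
set_option linter.unusedSectionVars false
open Set Filter Topology Metric
variable {p : ℕ} [Fact p.Prime]

lemma one_lt_pR : (1 : ℝ) < p := by exact_mod_cast (Fact.out : p.Prime).one_lt

lemma dist_eq_supIdx {x y : ℚ_[p]} (h : x ≠ y) : dist x y = (p : ℝ) ^ supIdx x y := by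
  rw [dist_eq_norm, Padic.norm_eq_zpow_neg_valuation (sub_ne_zero.2 h), supIdx]

lemma supIdx_le_iff {x y : ℚ_[p]} (h : x ≠ y) (k : ℤ) :
    supIdx x y ≤ k ↔ dist x y ≤ (p : ℝ) ^ k := by
  rw [dist_eq_supIdx h, zpow_le_zpow_iff_right₀ one_lt_pR]

lemma lt_supIdx_iff {x y : ℚ_[p]} (h : x ≠ y) (k : ℤ) :
    k < supIdx x y ↔ (p : ℝ) ^ k < dist x y := by
  rw [dist_eq_supIdx h, zpow_lt_zpow_iff_right₀ one_lt_pR]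

lemma dist_eq_of_ultra {x x' y : ℚ_[p]} (h : dist x x' < dist x y) : dist x y = dist x' y := by
  apply le_antisymm
  · rcases le_max_iff.1 (dist_triangle_max x x' y) with h1 | h1
    · linarith
    · exact h1
  · refine (dist_triangle_max x' x y).trans (max_le ?_ le_rfl)
    rw [dist_comm]; exact h.le

lemma supIdx_eq_of_dist {x y x' y' : ℚ_[p]} (h : x ≠ y) (h' : dist x y = dist x' y') :
    supIdx x y = supIdx x' y' := by
  have h2 : x' ≠ y' := by
    rw [← dist_pos, ← h', dist_pos]; exact h
  rw [dist_eq_supIdx h, dist_eq_supIdx h2] at h'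
  exact zpow_right_injective₀ (by linarith [one_lt_pR (p := p)]) (one_lt_pR (p := p)).ne' h'

lemma measurable_valuation [MeasurableSpace ℚ_[p]] [BorelSpace ℚ_[p]] :
    Measurable (fun x : ℚ_[p] => x.valuation) := by
  apply measurable_to_countable'
  intro k
  have : (fun x : ℚ_[p] => x.valuation) ⁻¹' {k} =
      ({x | ‖x‖ = (p : ℝ) ^ (-k)} ∪ (if k = 0 then {0} else ∅)) := by
    ext x
    by_cases hx : x = 0
    · subst hx
      have : (0 : ℝ) < (p : ℝ) ^ k := zpow_pos (by linarith [one_lt_pR (p := p)]) _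
      split_ifs with hk
      · simp [hk]
      · simp [this.ne, Ne.symm hk]
    · have h2 : x ∉ (if k = 0 then {0} else ∅ : Set ℚ_[p]) := by split_ifs <;> simp [hx]
      simp only [mem_preimage, mem_singleton_iff, mem_union, mem_ofPred_eq, h2, or_false]
      rw [Padic.norm_eq_zpow_neg_valuation hx]
      constructor
      · rintro rfl; rfl
      · intro h
        have := zpow_right_injective₀ (by linarith [one_lt_pR (p := p)])
          (one_lt_pR (p := p)).ne' h
        omega
  rw [this]
  refine MeasurableSet.union ?_ ?_
  · exact (isClosed_eq continuous_norm continuous_const).measurableSet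
  · split_ifs
    · exact measurableSet_singleton 0
    · exact MeasurableSet.empty

lemma measurable_supIdx [MeasurableSpace ℚ_[p]] [BorelSpace ℚ_[p]] (x : ℚ_[p]) :
    Measurable (fun y => supIdx x y) := by
  unfold supIdx
  exact (measurable_valuation.comp (measurable_id.const_sub x)).neg

lemma ball_cover (c : ℚ_[p]) (k : ℤ) :
    closedBall c ((p : ℝ) ^ (k + 1)) ⊆ ⋃ n ∈ Finset.range p,
      closedBall (c + (n : ℚ_[p]) * (p : ℚ_[p]) ^ (-(k + 1))) ((p : ℝ) ^ k) := by
  intro x hx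
  have hp0 : (0 : ℝ) < p := by linarith [one_lt_pR (p := p)]
  have hp0' : (p : ℚ_[p]) ≠ 0 := by exact_mod_cast (Fact.out : p.Prime).ne_zero
  rw [mem_closedBall, dist_eq_norm] at hx
  have h1 : ‖(x - c) * (p : ℚ_[p]) ^ (k + 1)‖ ≤ 1 := by
    rw [norm_mul, Padic.norm_p_zpow, zpow_neg]
    rw [← div_eq_mul_inv, div_le_one (by positivity)]; exact hx
  obtain ⟨n, hn, h⟩ := PadicInt.exists_mem_range (p := p) ⟨_, h1⟩
  simp only [mem_iUnion]
  refine ⟨n, Finset.mem_range.2 hn, ?_⟩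
  rw [PadicInt.maximalIdeal_eq_span_p, ← pow_one (p : ℤ_[p]),
    ← PadicInt.norm_le_pow_iff_mem_span_pow] at h
  have h' : ‖(x - c) * (p : ℚ_[p]) ^ (k + 1) - n‖ ≤ (p : ℝ) ^ (-((1 : ℕ) : ℤ)) := h
  rw [mem_closedBall, dist_eq_norm]
  have : x - (c + (n : ℚ_[p]) * (p : ℚ_[p]) ^ (-(k + 1))) =
      ((x - c) * (p : ℚ_[p]) ^ (k + 1) - n) * (p : ℚ_[p]) ^ (-(k + 1)) := by
    rw [sub_mul, mul_assoc, ← zpow_add₀ hp0']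
    simp; ring
  rw [this, norm_mul, Padic.norm_p_zpow]
  calc _ ≤ (p : ℝ) ^ (-(1 : ℤ)) * (p : ℝ) ^ (- -(k + 1)) := by
        gcongr; exact_mod_cast h'
    _ = _ := by rw [← zpow_add₀ hp0.ne']; congr 1; ring

lemma ball_measure_succ [MeasurableSpace ℚ_[p]] [BorelSpace ℚ_[p]]
    (μ : Measure ℚ_[p]) [μ.IsAddHaarMeasure] (c : ℚ_[p]) (k : ℤ) :
    μ.real (closedBall c ((p : ℝ) ^ (k + 1))) ≤ p * μ.real (closedBall c ((p : ℝ) ^ k)) := by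
  calc _ ≤ μ.real (⋃ n ∈ Finset.range p,
      closedBall (c + (n : ℚ_[p]) * (p : ℚ_[p]) ^ (-(k + 1))) ((p : ℝ) ^ k)) := by
        refine measureReal_mono (ball_cover c k) (measure_biUnion_lt_top (Finset.finite_toSet _) ?_).ne
        intro i _
        exact measure_closedBall_lt_top
    _ ≤ ∑ n ∈ Finset.range p, μ.real
        (closedBall (c + (n : ℚ_[p]) * (p : ℚ_[p]) ^ (-(k + 1))) ((p : ℝ) ^ k)) :=
        measureReal_biUnion_finset_le _ _
    _ = ∑ n ∈ Finset.range p, μ.real (closedBall c ((p : ℝ) ^ k)) := by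
        refine Finset.sum_congr rfl fun n _ => ?_
        simp only [Measure.real, Measure.addHaar_closedBall_center]
    _ = _ := by simp

lemma ball_measure_le [MeasurableSpace ℚ_[p]] [BorelSpace ℚ_[p]]
    (μ : Measure ℚ_[p]) [μ.IsAddHaarMeasure] (c : ℚ_[p]) (k : ℤ) (n : ℕ) :
    μ.real (closedBall c ((p : ℝ) ^ (k + n))) ≤
      (p : ℝ) ^ n * μ.real (closedBall c ((p : ℝ) ^ k)) := by
  induction n with
  | zero => simp
  | succ n ih =>
    have := ball_measure_succ μ c (k + n)
    push_cast
    rw [← add_assoc, pow_succ']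
    refine this.trans ?_
    rw [mul_assoc]
    gcongr

lemma bdd_of_const (φ : ℚ_[p] → ℝ) (γ : ℤ) (h : ∀ x y, dist x y ≤ (p : ℝ) ^ γ → φ x = φ y)
    (c : ℚ_[p]) (r : ℝ) : ∃ S : ℝ, 0 ≤ S ∧ ∀ x ∈ closedBall c r, φ x ≤ S := by
  have hp : (0 : ℝ) < (p : ℝ) ^ γ := zpow_pos (by linarith [one_lt_pR (p := p)]) _
  have hc : Continuous φ := by
    rw [continuous_iff_continuousAt]
    intro x
    refine (continuousAt_const (y := φ x)).congr ?_
    filter_upwards [closedBall_mem_nhds x hp] with y hy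
    exact (h y x hy).symm
  obtain ⟨S, hS⟩ := ((isCompact_closedBall c r).image hc).bddAbove
  exact ⟨max S 0, le_max_right _ _, fun x hx => (hS ⟨x, hx, rfl⟩).trans (le_max_left _ _)⟩

/-- A Gronwall-type uniqueness lemma for uniformly bounded families. -/
lemma gronwall_family {ι : Type*} (u u' : ι → ℝ → ℂ) (T K M : ℝ) (hK : 0 ≤ K) (hM : 0 ≤ M)
    (hb : ∀ i, ∀ t ∈ Icc 0 T, ‖u i t‖ ≤ M)
    (hc : ∀ i, ContinuousOn (u i) (Ici 0))
    (hd : ∀ i, ∀ t, 0 < t → HasDerivAt (u i) (u' i t) t)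
    (h0 : ∀ i, u i 0 = 0)
    (hder : ∀ t ∈ Ioc 0 T, ∀ C, 0 ≤ C → (∀ j, ‖u j t‖ ≤ C) → ∀ i, ‖u' i t‖ ≤ K * C) :
    ∀ i, ∀ t ∈ Icc 0 T, u i t = 0 := by
  have key : ∀ n : ℕ, ∀ i, ∀ t ∈ Icc 0 T, ‖u i t‖ ≤ M * (K * t) ^ n / n.factorial := by
    intro n
    induction n with
    | zero => intro i t ht; simpa using hb i t ht
    | succ n ih =>
      intro i t ht
      rcases eq_or_lt_of_le ht.1 with rfl | htpos
      · simp [h0]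
      set B : ℝ → ℝ := fun t => M * (K * t) ^ (n + 1) / (n + 1).factorial with hB
      have hBd : ∀ s, HasDerivAt B (K * (M * (K * s) ^ n / n.factorial)) s := by
        intro s
        have h1 : HasDerivAt (fun s : ℝ => K * s) K s := by
          simpa using (hasDerivAt_id s).const_mul K
        have := ((h1.pow (n + 1)).const_mul M).div_const ((n + 1).factorial : ℝ)
        refine (this.congr_deriv ?_)
        rw [Nat.factorial_succ]
        push_cast
        have : (n.factorial : ℝ) ≠ 0 := by positivity
        have : (n : ℝ) + 1 ≠ 0 := by positivity
        field_simp
      have hε : ∀ ε ∈ Ioo 0 t, ‖u i t - u i ε‖ ≤ B t := by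
        intro ε hε
        refine image_norm_le_of_norm_deriv_right_le_deriv_boundary (a := ε) (b := t)
          (f := fun s => u i s - u i ε) (f' := u' i) ?_ ?_ ?_ hBd ?_ ⟨hε.2.le, le_rfl⟩
        · exact ((hc i).mono fun s hs => hε.1.le.trans hs.1).sub continuousOn_const
        · intro s hs
          exact ((hd i s (hε.1.trans_le hs.1)).sub_const _).hasDerivWithinAt
        · have := hε.1
          simp only [sub_self, norm_zero, hB]; positivity
        · intro s hs
          have hs0 : 0 < s := hε.1.trans_le hs.1
          have hsT : s ≤ T := hs.2.le.trans ht.2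
          refine hder s ⟨hs0, hsT⟩ _ (by positivity) (fun j => ih j s ⟨hs0.le, hsT⟩) i
      have hlim : Tendsto (fun ε => ‖u i t - u i ε‖) (𝓝[>] 0) (𝓝 ‖u i t - u i 0‖) := by
        refine (tendsto_const_nhds.sub ?_).norm
        exact (hc i 0 (mem_Ici.2 le_rfl)).mono_left (nhdsWithin_mono _ Ioi_subset_Ici_self)
      have := le_of_tendsto hlim (by
        filter_upwards [Ioo_mem_nhdsGT htpos] with ε h using hε ε h)
      simpa [h0] using this
  intro i t ht
  have hl : Tendsto (fun n : ℕ => M * ((K * t) ^ n / n.factorial)) atTop (𝓝 (M * 0)) :=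
    (FloorSemiring.tendsto_pow_div_factorial_atTop (K * t)).const_mul M
  have : ‖u i t‖ ≤ M * 0 := by
    refine ge_of_tendsto hl (Eventually.of_forall fun n => ?_)
    rw [← mul_div_assoc]
    exact key n i t ht
  simpa using this


lemma integrable_tail [MeasurableSpace ℚ_[p]] [BorelSpace ℚ_[p]]
    (μ : Measure ℚ_[p]) [μ.IsAddHaarMeasure] (F : ℚ_[p] → ℤ → ℂ) (hFs : KernelSummable F)
    (c : ℚ_[p]) (R : ℤ) :
    IntegrableOn (fun η => ‖F c (supIdx c η)‖) (closedBall c ((p : ℝ) ^ R))ᶜ μ := by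
  have hp1 := one_lt_pR (p := p)
  have hp0 : (0 : ℝ) < p := by linarith
  have hp2 : (2 : ℝ) ≤ p := by exact_mod_cast (Fact.out : p.Prime).two_le
  set s : ℕ → Set ℚ_[p] := fun n => {η | dist c η = (p : ℝ) ^ (R + 1 + (n : ℤ))} with hs
  have hsub : ∀ n, s n ⊆ closedBall c ((p : ℝ) ^ (R + 1 + (n : ℤ))) := by
    intro n η hη
    rw [mem_closedBall, dist_comm]; exact le_of_eq hη
  have hms : ∀ n, MeasurableSet (s n) := fun n =>
    (isClosed_eq (continuous_const.dist continuous_id) continuous_const).measurableSet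
  have hval : ∀ n, ∀ η ∈ s n, supIdx c η = R + 1 + n := by
    intro n η hη
    have hη : dist c η = (p : ℝ) ^ (R + 1 + (n : ℤ)) := hη
    have hne : c ≠ η := by
      rw [← dist_pos, hη]; positivity
    rw [dist_eq_supIdx hne] at hη
    exact zpow_right_injective₀ hp0 hp1.ne' hη
  have hcov : (closedBall c ((p : ℝ) ^ R))ᶜ ⊆ ⋃ n, s n := by
    intro η hη
    rw [mem_compl_iff, mem_closedBall, not_le, dist_comm] at hη
    have hne : c ≠ η := by
      rw [← dist_pos]; exact lt_trans (by positivity) hη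
    have h1 := (lt_supIdx_iff hne R).2 hη
    obtain ⟨n, hn⟩ := Int.eq_ofNat_of_zero_le (a := supIdx c η - (R + 1)) (by omega)
    refine mem_iUnion.2 ⟨n, ?_⟩
    change dist c η = _
    rw [dist_eq_supIdx hne]; congr 1; omega
  have hfin : ∀ n, μ (s n) ≠ ⊤ := fun n =>
    ((measure_mono (hsub n)).trans_lt measure_closedBall_lt_top).ne
  refine IntegrableOn.mono_set ?_ hcov
  apply integrableOn_iUnion_of_summable_integral_norm
  · intro n
    have : IntegrableOn (fun _ : ℚ_[p] => ‖F c (R + 1 + n)‖) (s n) μ :=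
      integrableOn_const (hfin n)
    refine this.congr_fun ?_ (hms n)
    intro η hη
    simp only [hval n η hη]
  · set A := μ.real (closedBall c ((p : ℝ) ^ R)) with hA
    refine Summable.of_nonneg_of_le (fun n => integral_nonneg fun _ => norm_nonneg _) ?_
      ((hFs c R).mul_left (A * p * (p : ℝ) ^ (-R)))
    intro n
    have h1 : ∫ x in s n, ‖‖F c (supIdx c x)‖‖ ∂μ = ‖F c (R + 1 + n)‖ * μ.real (s n) := by
      rw [setIntegral_congr_fun (g := fun _ => ‖F c (R + 1 + n)‖) (hms n)]
      · simp [mul_comm]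
      · intro η hη
        simp only [hval n η hη, norm_norm]
    rw [h1]
    have h2 : μ.real (s n) ≤ (p : ℝ) ^ (n + 1) * A := by
      refine (measureReal_mono (hsub n) measure_closedBall_lt_top.ne).trans ?_
      have := ball_measure_le μ c R (n + 1)
      rw [show R + 1 + (n : ℤ) = R + ((n + 1 : ℕ) : ℤ) by push_cast; ring]
      exact this
    have h3 : (p : ℝ) ^ n ≤ (p : ℝ) ^ (-R) *
        ((p : ℝ) ^ (R + 1 + (n : ℤ)) - (p : ℝ) ^ (R + (n : ℤ))) := by
      rw [mul_sub, ← zpow_add₀ hp0.ne', ← zpow_add₀ hp0.ne',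
        show -R + (R + 1 + (n : ℤ)) = ((n + 1 : ℕ) : ℤ) by push_cast; ring,
        show -R + (R + (n : ℤ)) = (n : ℤ) by ring, zpow_natCast, zpow_natCast, pow_succ]
      nlinarith [pow_pos hp0 n]
    have hA0 : 0 ≤ A := measureReal_nonneg
    calc _ ≤ ‖F c (R + 1 + n)‖ * ((p : ℝ) ^ (n + 1) * A) := by gcongr
      _ = ‖F c (R + 1 + n)‖ * (A * p) * (p : ℝ) ^ n := by ring
      _ ≤ ‖F c (R + 1 + n)‖ * (A * p) * ((p : ℝ) ^ (-R) *
        ((p : ℝ) ^ (R + 1 + (n : ℤ)) - (p : ℝ) ^ (R + (n : ℤ)))) := by gcongr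
      _ = _ := by ring

lemma exists_majorant [MeasurableSpace ℚ_[p]] [BorelSpace ℚ_[p]]
    (μ : Measure ℚ_[p]) [μ.IsAddHaarMeasure] (F : ℚ_[p] → ℤ → ℂ) (hF : IsBallKernel F)
    (hFs : KernelSummable F) (c : ℚ_[p]) (γ R : ℤ) :
    ∃ (S : ℝ) (h : ℚ_[p] → ℝ), 0 ≤ S ∧ Integrable h μ ∧ (∀ η, 0 ≤ h η) ∧
      (∀ x ∈ closedBall c ((p : ℝ) ^ R), ∀ k, γ < k → k ≤ R → ‖F x k‖ ≤ S) ∧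
      ∀ x ∈ closedBall c ((p : ℝ) ^ R), ∀ η, (p : ℝ) ^ γ < dist x η →
        ∀ k, supIdx x η ≤ k → k ≤ max R (supIdx x η) → ‖F x k‖ ≤ h η := by
  have hp1 := one_lt_pR (p := p)
  have hp0 : (0 : ℝ) < p := by linarith
  obtain ⟨S, hS0, hS⟩ := bdd_of_const (fun x => ∑ k ∈ Finset.Ioc γ R, ‖F x k‖) γ (by
    intro x y hxy
    refine Finset.sum_congr rfl fun k hk => ?_
    rw [hF x y k (hxy.trans (zpow_le_zpow_right₀ hp1.le (Finset.mem_Ioc.1 hk).1.le))])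
    c ((p : ℝ) ^ R)
  have hS' : ∀ x ∈ closedBall c ((p : ℝ) ^ R), ∀ k, γ < k → k ≤ R → ‖F x k‖ ≤ S := by
    intro x hx k h1 h2
    exact (Finset.single_le_sum (f := fun k => ‖F x k‖) (fun _ _ => norm_nonneg _)
      (Finset.mem_Ioc.2 ⟨h1, h2⟩)).trans (hS x hx)
  classical
  refine ⟨S, fun η => (closedBall c ((p : ℝ) ^ R)).indicator (fun _ => S) η +
    (closedBall c ((p : ℝ) ^ R))ᶜ.indicator (fun η => ‖F c (supIdx c η)‖) η, hS0, ?_, ?_, hS', ?_⟩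
  · refine Integrable.add ?_ ?_
    · rw [integrable_indicator_iff measurableSet_closedBall]
      exact integrableOn_const measure_closedBall_lt_top.ne
    · rw [integrable_indicator_iff measurableSet_closedBall.compl]
      exact integrable_tail μ F hFs c R
  · intro η
    exact add_nonneg (indicator_nonneg (fun _ _ => hS0) _)
      (indicator_nonneg (fun _ _ => norm_nonneg _) _)
  · intro x hx η hη k hk1 hk2
    have hne : x ≠ η := by
      rw [← dist_pos]; exact lt_trans (by positivity) hη
    by_cases hB : η ∈ closedBall c ((p : ℝ) ^ R)
    · have h1 : supIdx x η ≤ R := by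
        rw [supIdx_le_iff hne]
        refine (dist_triangle_max x c η).trans (max_le hx ?_)
        rw [dist_comm]; exact hB
      rw [max_eq_left h1] at hk2
      simp only [indicator_of_mem hB, mem_compl_iff, hB, not_true, not_false_iff,
        indicator_of_notMem, add_zero]
      exact hS' x hx k (((lt_supIdx_iff hne γ).2 hη).trans_le hk1) hk2
    · have hB' : (p : ℝ) ^ R < dist c η := by
        rw [mem_closedBall, not_le, dist_comm] at hB; exact hB
      have hcx : dist c x ≤ (p : ℝ) ^ R := by rw [dist_comm]; exact hx
      have h1 : dist c η = dist x η := dist_eq_of_ultra (hcx.trans_lt hB')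
      have hne' : c ≠ η := by
        rw [← dist_pos, h1, dist_pos]; exact hne
      have h2 := supIdx_eq_of_dist hne' h1
      have h3 : R < supIdx x η := by
        rw [lt_supIdx_iff hne, ← h1]; exact hB'
      rw [max_eq_right h3.le] at hk2
      have hk : k = supIdx x η := le_antisymm hk2 hk1
      simp only [indicator_of_mem (show η ∈ (closedBall c ((p : ℝ) ^ R))ᶜ from hB), hB,
        not_false_iff, indicator_of_notMem, zero_add]
      rw [h2, ← hk, hF x c k]
      exact hx.trans (zpow_le_zpow_right₀ hp1.le (by omega))

/-- Hypotheses on a test function. -/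
structure Nice (f : ℚ_[p] → ℂ) (c : ℚ_[p]) (R γ : ℤ) (M : ℝ) : Prop where
  supp : ∀ x, x ∉ closedBall c ((p : ℝ) ^ R) → f x = 0
  const : ∀ x y, dist x y ≤ (p : ℝ) ^ γ → f x = f y
  bd : ∀ x, ‖f x‖ ≤ M

/-- A majorant of the kernel. -/
structure Maj [MeasurableSpace ℚ_[p]] (μ : Measure ℚ_[p]) (F : ℚ_[p] → ℤ → ℂ) (c : ℚ_[p])
    (R γ : ℤ) (S : ℝ) (h : ℚ_[p] → ℝ) : Prop where
  S0 : 0 ≤ S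
  int : Integrable h μ
  nn : ∀ η, 0 ≤ h η
  leS : ∀ x ∈ closedBall c ((p : ℝ) ^ R), ∀ k, γ < k → k ≤ R → ‖F x k‖ ≤ S
  leh : ∀ x ∈ closedBall c ((p : ℝ) ^ R), ∀ η, (p : ℝ) ^ γ < dist x η →
        ∀ k, supIdx x η ≤ k → k ≤ max R (supIdx x η) → ‖F x k‖ ≤ h η

lemma Nice.continuous {f : ℚ_[p] → ℂ} {c : ℚ_[p]} {R γ : ℤ} {M : ℝ} (hf : Nice f c R γ M) :
    Continuous f := by
  have hp : (0 : ℝ) < (p : ℝ) ^ γ := zpow_pos (by linarith [one_lt_pR (p := p)]) _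
  rw [continuous_iff_continuousAt]
  intro x
  refine (continuousAt_const (y := f x)).congr ?_
  filter_upwards [closedBall_mem_nhds x hp] with y hy
  exact (hf.const y x hy).symm

/-- Quadratic integrand. -/
noncomputable def quadI (F : ℚ_[p] → ℤ → ℂ) (f : ℚ_[p] → ℂ) (x : ℚ_[p])
    (z : ℚ_[p] × ℚ_[p]) : ℂ :=
  F x (max (supIdx x z.1) (supIdx x z.2)) * (f z.1 * (f z.2 - f x))

/-- Linear integrand. -/
noncomputable def linI (G : ℚ_[p] → ℤ → ℂ) (f : ℚ_[p] → ℂ) (x ξ : ℚ_[p]) : ℂ :=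
  G x (supIdx x ξ) * (f x - f ξ)

/-- Product weight. -/
noncomputable def wt (c : ℚ_[p]) (R : ℤ) (h : ℚ_[p] → ℝ) (z : ℚ_[p] × ℚ_[p]) : ℝ :=
  (closedBall c ((p : ℝ) ^ R)).indicator (fun _ => (1 : ℝ)) z.1 * h z.2

lemma sup3Idx_eq {x ξ η : ℚ_[p]} (h1 : ξ ≠ x) (h2 : η ≠ x) (h3 : η ≠ ξ) :
    sup3Idx x ξ η = max (supIdx x ξ) (supIdx x η) := by
  have : supIdx ξ η ≤ max (supIdx x ξ) (supIdx x η) := by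
    rw [supIdx_le_iff h3.symm]
    have hp1 := one_lt_pR (p := p)
    refine (dist_triangle_max ξ x η).trans (max_le ?_ ?_)
    · rw [dist_comm, dist_eq_supIdx h1.symm]
      exact zpow_le_zpow_right₀ hp1.le (le_max_left _ _)
    · rw [dist_eq_supIdx h2.symm]
      exact zpow_le_zpow_right₀ hp1.le (le_max_right _ _)
  unfold sup3Idx
  rw [← max_assoc, max_eq_left this]

variable [MeasurableSpace ℚ_[p]] [BorelSpace ℚ_[p]] {μ : Measure ℚ_[p]} [μ.IsAddHaarMeasure]
  {F G : ℚ_[p] → ℤ → ℂ} {f : ℚ_[p] → ℂ} {c : ℚ_[p]} {R γ : ℤ} {M S : ℝ} {h : ℚ_[p] → ℝ}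

lemma wt_nonneg (hm : Maj μ F c R γ S h) (z : ℚ_[p] × ℚ_[p]) : 0 ≤ wt c R h z :=
  mul_nonneg (indicator_nonneg (fun _ _ => zero_le_one) _) (hm.nn _)

lemma wt_int (hm : Maj μ F c R γ S h) : Integrable (wt c R h) (μ.prod μ) := by
  refine Integrable.mul_prod ?_ hm.int
  rw [integrable_indicator_iff measurableSet_closedBall]
  exact integrableOn_const measure_closedBall_lt_top.ne

lemma ae_fst (x : ℚ_[p]) : ∀ᵐ z ∂(μ.prod μ), z.1 ≠ x := by
  have : ∀ᵐ y ∂μ, y ≠ x := by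
    rw [ae_iff]; simp
  exact Measure.quasiMeasurePreserving_fst.ae this

lemma quad_le (hf : Nice f c R γ M) (hm : Maj μ F c R γ S h) {x : ℚ_[p]}
    (hx : x ∈ closedBall c ((p : ℝ) ^ R)) {z : ℚ_[p] × ℚ_[p]} (hz : z.1 ≠ x) :
    ‖quadI F f x z‖ ≤ wt c R h z * (‖f z.1‖ * ‖f z.2 - f x‖) := by
  unfold quadI wt
  by_cases hB : z.1 ∈ closedBall c ((p : ℝ) ^ R)
  · by_cases hη : (p : ℝ) ^ γ < dist x z.2
    · rw [indicator_of_mem hB, one_mul, norm_mul, norm_mul]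
      gcongr
      refine hm.leh x hx _ hη _ (le_max_right _ _) (max_le_max ?_ le_rfl)
      rw [supIdx_le_iff hz.symm]
      refine (dist_triangle_max x c z.1).trans (max_le hx ?_)
      rw [dist_comm]; exact hB
    · rw [hf.const x z.2 (not_lt.1 hη)]; simp
  · rw [hf.supp _ hB]; simp

lemma lin_le (hf : Nice f c R γ M) (hm : Maj μ G c R γ S h) {x : ℚ_[p]}
    (hx : x ∈ closedBall c ((p : ℝ) ^ R)) (ξ : ℚ_[p]) :
    ‖linI G f x ξ‖ ≤ h ξ * ‖f x - f ξ‖ := by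
  unfold linI
  by_cases hη : (p : ℝ) ^ γ < dist x ξ
  · rw [norm_mul]
    gcongr
    exact hm.leh x hx _ hη _ le_rfl (le_max_right _ _)
  · rw [hf.const x ξ (not_lt.1 hη)]; simp

lemma kmeas (F : ℚ_[p] → ℤ → ℂ) (x : ℚ_[p]) : Measurable (F x) := measurable_from_top

lemma quad_meas (hf : Nice f c R γ M) (x : ℚ_[p]) : Measurable (quadI F f x) := by
  unfold quadI
  have h1 := hf.continuous.measurable
  have h2 := measurable_supIdx x
  refine Measurable.mul ((kmeas F x).comp ?_) ?_
  · exact (h2.comp measurable_fst).max (h2.comp measurable_snd)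
  · exact (h1.comp measurable_fst).mul ((h1.comp measurable_snd).sub_const _)

lemma lin_meas (hf : Nice f c R γ M) (x : ℚ_[p]) : Measurable (linI G f x) := by
  unfold linI
  exact ((kmeas G x).comp (measurable_supIdx x)).mul (hf.continuous.measurable.const_sub _)

lemma quad_int (hf : Nice f c R γ M) (hm : Maj μ F c R γ S h) {x : ℚ_[p]}
    (hx : x ∈ closedBall c ((p : ℝ) ^ R)) : Integrable (quadI F f x) (μ.prod μ) := by
  refine Integrable.mono' ((wt_int hm).mul_const (M * (M + M)))
    (quad_meas hf x).aestronglyMeasurable ?_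
  filter_upwards [ae_fst x] with z hz
  refine (quad_le hf hm hx hz).trans ?_
  have h0 := wt_nonneg hm z
  have hM : 0 ≤ M := (norm_nonneg _).trans (hf.bd x)
  gcongr
  · exact hf.bd _
  · exact (norm_sub_le _ _).trans (add_le_add (hf.bd _) (hf.bd _))

lemma lin_int (hf : Nice f c R γ M) (hm : Maj μ G c R γ S h) {x : ℚ_[p]}
    (hx : x ∈ closedBall c ((p : ℝ) ^ R)) : Integrable (linI G f x) μ := by
  refine Integrable.mono' (hm.int.mul_const (M + M))
    (lin_meas hf x).aestronglyMeasurable (Eventually.of_forall fun ξ => ?_)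
  refine (lin_le hf hm hx ξ).trans ?_
  have h0 := hm.nn ξ
  gcongr
  exact (norm_sub_le _ _).trans (add_le_add (hf.bd _) (hf.bd _))

lemma cascadeOp_eq (hf : Nice f c R γ M) (hm : Maj μ F c R γ S h) {x : ℚ_[p]}
    (hx : x ∈ closedBall c ((p : ℝ) ^ R)) :
    cascadeOp μ F G f x = (∫ z, quadI F f x z ∂(μ.prod μ)) + ∫ ξ, linI G f x ξ ∂μ := by
  unfold cascadeOp
  congr 1
  rw [integral_prod _ (quad_int hf hm hx)]
  have hne : ∀ y : ℚ_[p], ∀ᵐ z ∂μ, z ≠ y := by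
    intro y; rw [ae_iff]; simp
  refine integral_congr_ae ?_
  filter_upwards [hne x] with ξ hξ
  refine integral_congr_ae ?_
  filter_upwards [hne x, hne ξ] with η h1 h2
  simp only [quadI, sup3Idx_eq hξ h1 h2]

/-- Estimate for the differences. -/
lemma est_diff {SG : ℝ} {hh : ℚ_[p] → ℝ} (hF : IsBallKernel F) (hG : IsBallKernel G)
    (hf : Nice f c R γ M) (hm : Maj μ F c R γ S h)
    (hmG : Maj μ G c R γ SG hh) {γ₀ : ℤ} (hγ : γ ≤ γ₀) {C : ℝ} (hC : 0 ≤ C)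
    (hd : ∀ y ∈ closedBall c ((p : ℝ) ^ R), ∀ y', dist y y' ≤ (p : ℝ) ^ γ₀ → ‖f y - f y'‖ ≤ C)
    {x x' : ℚ_[p]} (hx : x ∈ closedBall c ((p : ℝ) ^ R))
    (hx' : x' ∈ closedBall c ((p : ℝ) ^ R)) (hxx : dist x x' ≤ (p : ℝ) ^ γ₀) :
    ‖cascadeOp μ F G f x - cascadeOp μ F G f x'‖ ≤
      ((∫ z, wt c R h z ∂(μ.prod μ)) * (M + M) + (∫ ξ, hh ξ ∂μ) * 2) * C := by
  have hp1 := one_lt_pR (p := p)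
  have hM : 0 ≤ M := (norm_nonneg _).trans (hf.bd x)
  have hxx' : dist x' x ≤ (p : ℝ) ^ γ₀ := by rw [dist_comm]; exact hxx
  -- geometric facts
  have far : ∀ η, (p : ℝ) ^ γ₀ < dist x η → supIdx x η = supIdx x' η ∧ γ₀ < supIdx x η := by
    intro η hη
    have hne : x ≠ η := by
      rw [← dist_pos]; exact dist_nonneg.trans_lt (hxx.trans_lt hη)
    exact ⟨supIdx_eq_of_dist hne (dist_eq_of_ultra (hxx.trans_lt hη)),
      (lt_supIdx_iff hne _).2 hη⟩
  have near : ∀ η, ¬ (p : ℝ) ^ γ₀ < dist x η → dist x' η ≤ (p : ℝ) ^ γ₀ := by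
    intro η hη
    exact (dist_triangle_max x' x η).trans (max_le hxx' (not_lt.1 hη))
  rw [cascadeOp_eq hf hm hx, cascadeOp_eq hf hm hx', add_sub_add_comm,
    ← integral_sub (quad_int hf hm hx) (quad_int hf hm hx'),
    ← integral_sub (lin_int hf hmG hx) (lin_int hf hmG hx'), add_mul]
  refine (norm_add_le _ _).trans (add_le_add ?_ ?_)
  · rw [mul_assoc, ← integral_mul_const]
    refine norm_integral_le_of_norm_le ((wt_int hm).mul_const _) ?_
    filter_upwards [ae_fst x, ae_fst x'] with z hz hz'
    have h0 := wt_nonneg hm z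
    by_cases hη : (p : ℝ) ^ γ₀ < dist x z.2
    · obtain ⟨e1, e2⟩ := far _ hη
      have hk : max (supIdx x z.1) (supIdx x z.2) = max (supIdx x' z.1) (supIdx x' z.2) := by
        by_cases hξ : (p : ℝ) ^ γ₀ < dist x z.1
        · rw [(far _ hξ).1, e1]
        · have a1 := (supIdx_le_iff hz.symm γ₀).2 (not_lt.1 hξ)
          have a2 := (supIdx_le_iff hz'.symm γ₀).2 (near _ hξ)
          rw [max_eq_right (by omega), max_eq_right (by omega), e1]
      have hk2 : γ₀ ≤ max (supIdx x z.1) (supIdx x z.2) := e2.le.trans (le_max_right _ _)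
      have hq : quadI F f x z - quadI F f x' z =
          F x (max (supIdx x z.1) (supIdx x z.2)) * (f z.1 * (f x' - f x)) := by
        unfold quadI
        rw [← hk, hF x' x _ (hxx'.trans (zpow_le_zpow_right₀ hp1.le hk2))]
        ring
      rw [hq, norm_mul, norm_mul]
      have hKle : ‖F x (max (supIdx x z.1) (supIdx x z.2))‖ * ‖f z.1‖ ≤ wt c R h z * M := by
        by_cases hB : z.1 ∈ closedBall c ((p : ℝ) ^ R)
        · unfold wt
          rw [indicator_of_mem hB, one_mul]
          have hhn := hm.nn z.2
          gcongr
          · refine hm.leh x hx _ ((zpow_le_zpow_right₀ hp1.le hγ).trans_lt hη) _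
              (le_max_right _ _) (max_le_max ?_ le_rfl)
            rw [supIdx_le_iff hz.symm]
            refine (dist_triangle_max x c z.1).trans (max_le hx ?_)
            rw [dist_comm]; exact hB
          · exact hf.bd _
        · rw [hf.supp _ hB, norm_zero, mul_zero]; positivity
      rw [← mul_assoc]
      calc _ ≤ (wt c R h z * M) * C := by
            gcongr
            exact hd x' hx' x hxx'
        _ ≤ wt c R h z * ((M + M) * C) := by
            have : 0 ≤ wt c R h z * M * C := by positivity
            nlinarith
    · have b1 : ‖f z.2 - f x‖ ≤ C := by
        rw [norm_sub_rev]; exact hd x hx _ (not_lt.1 hη)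
      have b2 : ‖f z.2 - f x'‖ ≤ C := by
        rw [norm_sub_rev]; exact hd x' hx' _ (near _ hη)
      have b3 := hf.bd z.1
      calc _ ≤ ‖quadI F f x z‖ + ‖quadI F f x' z‖ := norm_sub_le _ _
        _ ≤ wt c R h z * (‖f z.1‖ * ‖f z.2 - f x‖) + wt c R h z * (‖f z.1‖ * ‖f z.2 - f x'‖) :=
            add_le_add (quad_le hf hm hx hz) (quad_le hf hm hx' hz')
        _ ≤ wt c R h z * (M * C) + wt c R h z * (M * C) := by gcongr
        _ = _ := by ring
  · rw [mul_assoc, ← integral_mul_const]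
    refine norm_integral_le_of_norm_le (hmG.int.mul_const _) (Eventually.of_forall fun ξ => ?_)
    have h0 := hmG.nn ξ
    by_cases hη : (p : ℝ) ^ γ₀ < dist x ξ
    · obtain ⟨e1, e2⟩ := far _ hη
      have hq : linI G f x ξ - linI G f x' ξ = G x (supIdx x ξ) * (f x - f x') := by
        unfold linI
        rw [← e1, hG x' x _ (hxx'.trans (zpow_le_zpow_right₀ hp1.le e2.le))]
        ring
      rw [hq, norm_mul]
      calc _ ≤ hh ξ * C := by
            gcongr
            · exact hmG.leh x hx _ ((zpow_le_zpow_right₀ hp1.le hγ).trans_lt hη) _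
                le_rfl (le_max_right _ _)
            · exact hd x hx x' hxx
        _ ≤ _ := by nlinarith [mul_nonneg h0 hC]
    · have b1 : ‖f x - f ξ‖ ≤ C := hd x hx _ (not_lt.1 hη)
      have b2 : ‖f x' - f ξ‖ ≤ C := hd x' hx' _ (near _ hη)
      calc _ ≤ ‖linI G f x ξ‖ + ‖linI G f x' ξ‖ := norm_sub_le _ _
        _ ≤ hh ξ * ‖f x - f ξ‖ + hh ξ * ‖f x' - f ξ‖ :=
            add_le_add (lin_le hf hmG hx ξ) (lin_le hf hmG hx' ξ)
        _ ≤ hh ξ * C + hh ξ * C := by gcongr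
        _ = _ := by ring

/-- Estimate outside of the ball. -/
lemma est_supp {SG : ℝ} {hh : ℚ_[p] → ℝ}
    (hf : Nice f c R γ M) (hm : Maj μ F c R γ S h)
    (hmG : Maj μ G c R γ SG hh) {γB : ℤ} {c₀ : ℚ_[p]} (hγ : γ ≤ γB)
    (hsub : closedBall c₀ ((p : ℝ) ^ γB) ⊆ closedBall c ((p : ℝ) ^ R))
    (hmean : ∫ x, f x ∂μ = 0) {C : ℝ} (hC : 0 ≤ C)
    (hd : ∀ y ∈ closedBall c ((p : ℝ) ^ R), y ∉ closedBall c₀ ((p : ℝ) ^ γB) → ‖f y‖ ≤ C)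
    {x : ℚ_[p]} (hx : x ∈ closedBall c ((p : ℝ) ^ R))
    (hx0 : x ∉ closedBall c₀ ((p : ℝ) ^ γB)) :
    ‖cascadeOp μ F G f x‖ ≤
      ((∫ z, wt c R h z ∂(μ.prod μ)) * (M + M) +
        S * μ.real (closedBall c ((p : ℝ) ^ R)) * (M * μ.real (closedBall c ((p : ℝ) ^ R))) +
        ((∫ ξ, hh ξ ∂μ) * 2 + SG * μ.real (closedBall c ((p : ℝ) ^ R)))) * C := by
  have hp1 := one_lt_pR (p := p)
  have hM : 0 ≤ M := (norm_nonneg _).trans (hf.bd x)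
  set B := closedBall c ((p : ℝ) ^ R) with hBdef
  set B₀ := closedBall c₀ ((p : ℝ) ^ γB) with hB₀def
  have hBm : MeasurableSet B := measurableSet_closedBall
  have hB₀m : MeasurableSet B₀ := measurableSet_closedBall
  have hBf : μ B ≠ ⊤ := measure_closedBall_lt_top.ne
  have hB₀f : μ B₀ ≠ ⊤ := measure_closedBall_lt_top.ne
  have hd' : ∀ y, y ∉ B₀ → ‖f y‖ ≤ C := by
    intro y hy
    by_cases hyB : y ∈ B
    · exact hd y hyB hy
    · rw [hf.supp y hyB, norm_zero]; exact hC
  set r := supIdx x c₀ with hr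
  have hx0' : (p : ℝ) ^ γB < dist x c₀ := by simpa [hB₀def] using hx0
  have hne : x ≠ c₀ := by
    rw [← dist_pos]; exact lt_trans (zpow_pos (by linarith) _) hx0'
  have hc₀B : c₀ ∈ B := hsub (mem_closedBall_self (zpow_nonneg (by linarith) _))
  have hrγ : γ < r := hγ.trans_lt ((lt_supIdx_iff hne _).2 hx0')
  have hrR : r ≤ R := by
    rw [hr, supIdx_le_iff hne]
    refine (dist_triangle_max x c c₀).trans (max_le hx ?_)
    rw [dist_comm]; exact hc₀B
  have hsup : ∀ ξ ∈ B₀, supIdx x ξ = r ∧ (p : ℝ) ^ γ < dist x ξ := by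
    intro ξ hξ
    have h1 : dist c₀ ξ < dist c₀ x := by
      rw [dist_comm c₀ ξ, dist_comm c₀ x]; exact lt_of_le_of_lt hξ hx0'
    have h2 : dist c₀ x = dist ξ x := dist_eq_of_ultra h1
    rw [dist_comm c₀, dist_comm ξ] at h2
    refine ⟨(supIdx_eq_of_dist hne h2).symm, ?_⟩
    rw [← h2]
    exact (zpow_le_zpow_right₀ hp1.le hγ).trans_lt hx0'
  have hfint : Integrable f μ := by
    have h1 : Integrable (B.indicator fun _ => M) μ := by
      rw [integrable_indicator_iff hBm]; exact integrableOn_const hBf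
    refine h1.mono' hf.continuous.measurable.aestronglyMeasurable
      (Eventually.of_forall fun y => ?_)
    by_cases hy : y ∈ B
    · rw [indicator_of_mem hy]; exact hf.bd y
    · rw [hf.supp y hy, indicator_of_notMem hy, norm_zero]
  set φ : ℚ_[p] → ℂ := B₀.indicator f with hφ
  have hφint : Integrable φ μ := hfint.indicator hB₀m
  have hφ1 : ‖∫ y, φ y ∂μ‖ ≤ C * μ.real B := by
    have e : ∫ y, φ y ∂μ = ∫ y, (φ y - f y) ∂μ := by
      rw [integral_sub hφint hfint, hmean, sub_zero]
    have e2 : C * μ.real B = ∫ y, B.indicator (fun _ => C) y ∂μ := by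
      rw [integral_indicator hBm]; simp [mul_comm]
    rw [e, e2]
    refine norm_integral_le_of_norm_le ?_ (Eventually.of_forall fun y => ?_)
    · rw [integrable_indicator_iff hBm]; exact integrableOn_const hBf
    · by_cases hy : y ∈ B
      · rw [indicator_of_mem hy]
        by_cases hy0 : y ∈ B₀
        · rw [hφ, indicator_of_mem hy0, sub_self, norm_zero]; exact hC
        · rw [hφ, indicator_of_notMem hy0, zero_sub, norm_neg]; exact hd' y hy0
      · rw [indicator_of_notMem hy, hφ, indicator_of_notMem (fun h => hy (hsub h)),
          hf.supp y hy]; simp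
  have hφ2 : ‖∫ y, φ y ∂μ‖ ≤ M * μ.real B := by
    have e2 : M * μ.real B = ∫ y, B.indicator (fun _ => M) y ∂μ := by
      rw [integral_indicator hBm]; simp [mul_comm]
    rw [e2]
    refine norm_integral_le_of_norm_le ?_ (Eventually.of_forall fun y => ?_)
    · rw [integrable_indicator_iff hBm]; exact integrableOn_const hBf
    · by_cases hy0 : y ∈ B₀
      · rw [hφ, indicator_of_mem hy0, indicator_of_mem (hsub hy0)]; exact hf.bd y
      · rw [hφ, indicator_of_notMem hy0, norm_zero]
        exact indicator_nonneg (fun _ _ => hM) _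
  have hBr : 0 ≤ μ.real B := measureReal_nonneg
  have hFr : ‖F x r‖ ≤ S := hm.leS x hx r hrγ hrR
  have hGr : ‖G x r‖ ≤ SG := hmG.leS x hx r hrγ hrR
  rw [cascadeOp_eq hf hm hx, add_mul]
  refine (norm_add_le _ _).trans (add_le_add ?_ ?_)
  · have hpi : Integrable (fun z : ℚ_[p] × ℚ_[p] => φ z.1 * φ z.2) (μ.prod μ) :=
      hφint.mul_prod hφint
    have e : ∫ z, quadI F f x z ∂(μ.prod μ) =
        ∫ z, (quadI F f x z - F x r * (φ z.1 * φ z.2)) ∂(μ.prod μ) +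
          F x r * ((∫ y, φ y ∂μ) * ∫ y, φ y ∂μ) := by
      rw [integral_sub (quad_int hf hm hx) (hpi.const_mul _), integral_const_mul,
        integral_prod_mul]
      ring
    rw [e, add_mul]
    refine (norm_add_le _ _).trans (add_le_add ?_ ?_)
    · rw [mul_assoc, ← integral_mul_const]
      refine norm_integral_le_of_norm_le ((wt_int hm).mul_const _) ?_
      filter_upwards [ae_fst x] with z hz
      have h0 := wt_nonneg hm z
      have hfx := hd' x hx0
      have hMC : 0 ≤ M * C := by positivity
      by_cases h1 : z.1 ∈ B₀
      · by_cases h2 : z.2 ∈ B₀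
        · have hq : quadI F f x z - F x r * (φ z.1 * φ z.2) = F x r * (f z.1 * (- f x)) := by
            unfold quadI
            rw [(hsup _ h1).1, (hsup _ h2).1, max_self, hφ, indicator_of_mem h1,
              indicator_of_mem h2]
            ring
          have hk : ‖F x r‖ ≤ wt c R h z := by
            unfold wt
            rw [indicator_of_mem (hsub h1), one_mul]
            exact hm.leh x hx _ (hsup _ h2).2 _ (hsup _ h2).1.le (hrR.trans (le_max_left _ _))
          rw [hq, norm_mul, norm_mul, norm_neg]
          calc _ ≤ wt c R h z * (M * C) := by
                gcongr
                exact hf.bd _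
            _ ≤ _ := by
                gcongr
                linarith
        · have hq : φ z.2 = 0 := indicator_of_notMem h2 _
          rw [hq, mul_zero, mul_zero, sub_zero]
          refine (quad_le hf hm hx hz).trans ?_
          have : ‖f z.2 - f x‖ ≤ C + C := (norm_sub_le _ _).trans (add_le_add (hd' _ h2) hfx)
          calc _ ≤ wt c R h z * (M * (C + C)) := by
                gcongr
                exact hf.bd _
            _ = _ := by ring
      · have hq : φ z.1 = 0 := indicator_of_notMem h1 _
        rw [hq, zero_mul, mul_zero, sub_zero]
        refine (quad_le hf hm hx hz).trans ?_
        have : ‖f z.2 - f x‖ ≤ M + M :=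
          (norm_sub_le _ _).trans (add_le_add (hf.bd _) (hf.bd _))
        calc _ ≤ wt c R h z * (C * (M + M)) := by
              gcongr
              exact hd' _ h1
          _ = _ := by ring
    · rw [norm_mul, norm_mul]
      have := hm.S0
      calc _ ≤ S * ((C * μ.real B) * (M * μ.real B)) := by gcongr
        _ = _ := by ring
  · have e : ∫ ξ, linI G f x ξ ∂μ =
        ∫ ξ, (linI G f x ξ + G x r * φ ξ) ∂μ - G x r * ∫ ξ, φ ξ ∂μ := by
      rw [integral_add (lin_int hf hmG hx) (hφint.const_mul _), integral_const_mul]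
      ring
    rw [e, add_mul]
    refine (norm_sub_le _ _).trans (add_le_add ?_ ?_)
    · rw [mul_assoc, ← integral_mul_const]
      refine norm_integral_le_of_norm_le (hmG.int.mul_const _) (Eventually.of_forall fun ξ => ?_)
      have h0 := hmG.nn ξ
      have hfx := hd' x hx0
      by_cases h1 : ξ ∈ B₀
      · have hq : linI G f x ξ + G x r * φ ξ = G x r * f x := by
          unfold linI
          rw [(hsup _ h1).1, hφ, indicator_of_mem h1]; ring
        rw [hq, norm_mul]
        calc _ ≤ hh ξ * C := by
              gcongr
              exact hmG.leh x hx _ (hsup _ h1).2 _ (hsup _ h1).1.le (hrR.trans (le_max_left _ _))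
          _ ≤ _ := by nlinarith [mul_nonneg h0 hC]
      · have hq : φ ξ = 0 := indicator_of_notMem h1 _
        rw [hq, mul_zero, add_zero]
        refine (lin_le hf hmG hx ξ).trans ?_
        gcongr
        refine (norm_sub_le _ _).trans ?_
        linarith [hd' _ h1]
    · rw [norm_mul]
      have := hmG.S0
      calc _ ≤ SG * (C * μ.real B) := by gcongr
        _ = _ := by ring
end helpers

/-- Localization of solutions: if the initial condition `v₀ ∈ D_0(ℚ_p)`
vanishes outside the ball `B₀ = B(c₀, p^γB)` and is constant on every ball of radius
`p^γ₀`, then the solution `v` of the Cauchy problem for the quadratic cascade equation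
keeps these properties for every `t ≥ 0`. -/
theorem cascade_solution_localized {p : ℕ} [Fact p.Prime]
    [MeasurableSpace ℚ_[p]] [BorelSpace ℚ_[p]]
    (μ : Measure ℚ_[p]) [μ.IsAddHaarMeasure] (hμ : μ (Metric.closedBall 0 1) = 1)
    (F G : ℚ_[p] → ℤ → ℂ) (hF : IsBallKernel F) (hG : IsBallKernel G)
    (hFs : KernelSummable F) (hGs : KernelSummable G)
    (v₀ : ℚ_[p] → ℂ) (c₀ : ℚ_[p]) (γB γ₀ : ℤ)
    (hv₀supp : ∀ x, (p : ℝ) ^ γB < dist x c₀ → v₀ x = 0)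
    (hv₀lc : ∀ x y, dist x y ≤ (p : ℝ) ^ γ₀ → v₀ x = v₀ y)
    (hv₀mean : (∫ x, v₀ x ∂μ) = 0)
    (v : ℚ_[p] → ℝ → ℂ)
    (hvD : ∃ (c₁ : ℚ_[p]) (γB' γ₁ : ℤ), ∀ t : ℝ, 0 ≤ t →
      (∀ x, (p : ℝ) ^ γB' < dist x c₁ → v x t = 0) ∧
      (∀ x y, dist x y ≤ (p : ℝ) ^ γ₁ → v x t = v y t) ∧
      (∫ x, v x t ∂μ) = 0)
    (hvC : ∀ x, ContDiffOn ℝ 1 (fun t => v x t) (Set.Ici (0 : ℝ)))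
    (hveq : SatisfiesCascade μ F G v)
    (hv0 : ∀ x, v x 0 = v₀ x) :
    ∀ t : ℝ, 0 ≤ t →
      (∀ x, (p : ℝ) ^ γB < dist x c₀ → v x t = 0) ∧
      (∀ x y, dist x y ≤ (p : ℝ) ^ γ₀ → v x t = v y t) := by
  intro T hT
  obtain ⟨c, γB', γ₁, hv⟩ := hvD
  have hp1 := one_lt_pR (p := p)
  have hp0 : (0 : ℝ) < p := by linarith
  set γ := min γ₁ (min γ₀ γB) with hγdef
  have hγ1 : γ ≤ γ₁ := min_le_left _ _
  have hγ0 : γ ≤ γ₀ := (min_le_right _ _).trans (min_le_left _ _)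
  have hγB : γ ≤ γB := (min_le_right _ _).trans (min_le_right _ _)
  obtain ⟨n, hn⟩ := pow_unbounded_of_one_lt (dist c₀ c) hp1
  set R : ℤ := max (n : ℤ) (max γB' (max γ₀ γB)) with hRdef
  have hRn : (n : ℤ) ≤ R := le_max_left _ _
  have hRB' : γB' ≤ R := (le_max_left _ _).trans (le_max_right _ _)
  have hR0 : γ₀ ≤ R := ((le_max_left _ _).trans (le_max_right _ _)).trans (le_max_right _ _)
  have hRB : γB ≤ R := ((le_max_right _ _).trans (le_max_right _ _)).trans (le_max_right _ _)
  have hc₀ : dist c₀ c ≤ (p : ℝ) ^ R := by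
    refine hn.le.trans ?_
    rw [← zpow_natCast]
    exact zpow_le_zpow_right₀ hp1.le hRn
  have hsub : Metric.closedBall c₀ ((p : ℝ) ^ γB) ⊆ Metric.closedBall c ((p : ℝ) ^ R) := by
    intro y hy
    exact (dist_triangle_max y c₀ c).trans
      (max_le (le_trans hy (zpow_le_zpow_right₀ hp1.le hRB)) hc₀)
  have hsupp : ∀ t : ℝ, 0 ≤ t → ∀ x, x ∉ Metric.closedBall c ((p : ℝ) ^ R) → v x t = 0 := by
    intro t ht x hx
    refine (hv t ht).1 x ?_
    rw [Metric.mem_closedBall, not_le] at hx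
    exact (zpow_le_zpow_right₀ hp1.le hRB').trans_lt hx
  have hcont : ∀ x, ContinuousOn (fun t => v x t) (Set.Ici 0) := fun x => (hvC x).continuousOn
  -- uniform bound
  have hbdd : ∀ x, BddAbove ((fun t => ‖v x t‖) '' Set.Icc 0 T) := fun x =>
    (isCompact_Icc.image_of_continuousOn
      ((hcont x).norm.mono fun t ht => ht.1)).bddAbove
  obtain ⟨M, hM0, hM⟩ := bdd_of_const (fun x => sSup ((fun t => ‖v x t‖) '' Set.Icc 0 T)) γ₁ (by
    intro x y hxy
    have : (fun t => ‖v x t‖) '' Set.Icc 0 T = (fun t => ‖v y t‖) '' Set.Icc 0 T := by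
      refine Set.image_congr fun t ht => ?_
      simp only [(hv t ht.1).2.1 x y hxy]
    simp only [this]) c ((p : ℝ) ^ R)
  have hbd : ∀ t ∈ Set.Icc 0 T, ∀ x, ‖v x t‖ ≤ M := by
    intro t ht x
    by_cases hx : x ∈ Metric.closedBall c ((p : ℝ) ^ R)
    · exact (le_csSup (hbdd x) ⟨t, ht, rfl⟩).trans (hM x hx)
    · rw [hsupp t ht.1 x hx, norm_zero]; exact hM0
  have hnice : ∀ t ∈ Set.Icc 0 T, Nice (fun y => v y t) c R γ M := fun t ht =>
    ⟨hsupp t ht.1, fun x y hxy => (hv t ht.1).2.1 x y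
      (hxy.trans (zpow_le_zpow_right₀ hp1.le hγ1)), hbd t ht⟩
  obtain ⟨S, h, a1, a2, a3, a4, a5⟩ := exists_majorant μ F hF hFs c γ R
  have hm : Maj μ F c R γ S h := ⟨a1, a2, a3, a4, a5⟩
  obtain ⟨SG, hh, b1, b2, b3, b4, b5⟩ := exists_majorant μ G hG hGs c γ R
  have hmG : Maj μ G c R γ SG hh := ⟨b1, b2, b3, b4, b5⟩
  have hW : 0 ≤ ∫ z, wt c R h z ∂(μ.prod μ) := integral_nonneg fun z => wt_nonneg hm z
  have hH : 0 ≤ ∫ ξ, hh ξ ∂μ := integral_nonneg b3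
  have hBr : 0 ≤ μ.real (Metric.closedBall c ((p : ℝ) ^ R)) := measureReal_nonneg
  constructor
  · intro x hx
    by_cases hxB : x ∈ Metric.closedBall c ((p : ℝ) ^ R)
    swap
    · exact hsupp T hT x hxB
    let ι := {y : ℚ_[p] // y ∈ Metric.closedBall c ((p : ℝ) ^ R) ∧
      y ∉ Metric.closedBall c₀ ((p : ℝ) ^ γB)}
    refine gronwall_family (ι := ι) (fun i t => v i.1 t)
      (fun i t => -(cascadeOp μ F G (fun y => v y t) i.1)) T
      ((∫ z, wt c R h z ∂(μ.prod μ)) * (M + M) +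
        S * μ.real (Metric.closedBall c ((p : ℝ) ^ R)) *
          (M * μ.real (Metric.closedBall c ((p : ℝ) ^ R))) +
        ((∫ ξ, hh ξ ∂μ) * 2 + SG * μ.real (Metric.closedBall c ((p : ℝ) ^ R))))
      M (by positivity) hM0 (fun i t ht => hbd t ht _) (fun i => hcont _)
      (fun i t ht => hveq i.1 t ht) ?_ ?_ ⟨x, hxB, ?_⟩ T ⟨hT, le_rfl⟩
    · intro i
      rw [hv0]
      exact hv₀supp _ (by simpa using i.2.2)
    · intro t ht C hC hj i
      rw [norm_neg]
      refine est_supp (hnice t ⟨ht.1.le, ht.2⟩) hm hmG hγB hsub (hv t ht.1.le).2.2 hC ?_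
        i.2.1 i.2.2
      intro y h1 h2
      exact hj ⟨y, h1, h2⟩
    · simpa using hx
  · intro x y hxy
    have hyx : ∀ x y : ℚ_[p], dist x y ≤ (p : ℝ) ^ γ₀ →
        x ∈ Metric.closedBall c ((p : ℝ) ^ R) → y ∈ Metric.closedBall c ((p : ℝ) ^ R) := by
      intro x y hxy hx
      refine (dist_triangle_max y x c).trans (max_le ?_ hx)
      rw [dist_comm]
      exact hxy.trans (zpow_le_zpow_right₀ hp1.le hR0)
    by_cases hxB : x ∈ Metric.closedBall c ((p : ℝ) ^ R)
    swap
    · rw [hsupp T hT x hxB, hsupp T hT y]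
      exact fun hy => hxB (hyx y x (by rw [dist_comm]; exact hxy) hy)
    let ι := {z : ℚ_[p] × ℚ_[p] // z.1 ∈ Metric.closedBall c ((p : ℝ) ^ R) ∧
      dist z.1 z.2 ≤ (p : ℝ) ^ γ₀}
    refine sub_eq_zero.1 (gronwall_family (ι := ι) (fun i t => v i.1.1 t - v i.1.2 t)
      (fun i t => -(cascadeOp μ F G (fun y => v y t) i.1.1) -
        -(cascadeOp μ F G (fun y => v y t) i.1.2)) T
      ((∫ z, wt c R h z ∂(μ.prod μ)) * (M + M) + (∫ ξ, hh ξ ∂μ) * 2)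
      (M + M) (by positivity) (by positivity)
      (fun i t ht => (norm_sub_le _ _).trans (add_le_add (hbd t ht _) (hbd t ht _)))
      (fun i => (hcont _).sub (hcont _))
      (fun i t ht => (hveq i.1.1 t ht).sub (hveq i.1.2 t ht)) ?_ ?_ ⟨(x, y), hxB, hxy⟩
      T ⟨hT, le_rfl⟩)
    · intro i
      simp only [hv0]
      rw [hv₀lc _ _ i.2.2, sub_self]
    · intro t ht C hC hj i
      rw [← neg_sub', norm_neg]
      refine est_diff hF hG (hnice t ⟨ht.1.le, ht.2⟩) hm hmG hγ0 hC ?_ i.2.1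
        (hyx _ _ i.2.2 i.2.1) i.2.2
      intro y h1 y' h2
      exact hj ⟨(y, y'), h1, h2⟩
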